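/- Let φ₁,…,φ₆ be real numbers satisfying: φᵢ > 0 for all i; φ₁+φ₂+φ₃+φ₄+φ₅+φ₆ < 2π; φᵢ+φᵢ₊₁ < π for i = 1,…,5; φ₁+φ₆ < π; φ₁+φ₂+φ₃ > φ₄+φ₅+φ₆; φ₃+φ₄+φ₅ > φ₁+φ₂+φ₆; φ₂+φ₃+φ₄ > φ₁+φ₅+φ₆; and φ₁+φ₂+φ₃+φ₄+φ₅+φ₆ ≠ π. Then the 6×6 matrix A(φ) (case 13.1) is an extremal matrix of the copositive cone COP_6. -/

import Mathlib

open Matrix Real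

/-- The copositive cone. -/
def Copositive (n : ℕ) : Set (Matrix (Fin n) (Fin n) ℝ) :=
  {A | A.IsSymm ∧ ∀ x : Fin n → ℝ, (∀ i, 0 ≤ x i) → 0 ≤ x ⬝ᵥ A *ᵥ x}

/-- Extremal matrices of the copositive cone. -/
def IsExtremalCopositive (n : ℕ) (A : Matrix (Fin n) (Fin n) ℝ) : Prop :=
  A ∈ Copositive n ∧ A ≠ 0 ∧
    ∀ A₁ A₂ : Matrix (Fin n) (Fin n) ℝ, A₁ ∈ Copositive n → A₂ ∈ Copositive n →
      A = A₁ + A₂ → ∃ c₁ c₂ : ℝ, 0 ≤ c₁ ∧ 0 ≤ c₂ ∧ A₁ = c₁ • A ∧ A₂ = c₂ • A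

/-- The matrix `A(φ)` of case 13.1. -/
noncomputable def A131 (φ₁ φ₂ φ₃ φ₄ φ₅ φ₆ : ℝ) : Matrix (Fin 6) (Fin 6) ℝ :=
  !![1, -cos φ₁, cos (φ₁+φ₂), -cos (φ₁+φ₂+φ₃), cos (φ₅+φ₆), -cos φ₆;
     -cos φ₁, 1, -cos φ₂, cos (φ₂+φ₃), -cos (φ₂+φ₃+φ₄), cos (φ₁+φ₆);
     cos (φ₁+φ₂), -cos φ₂, 1, -cos φ₃, cos (φ₃+φ₄), -cos (φ₃+φ₄+φ₅);
     -cos (φ₁+φ₂+φ₃), cos (φ₂+φ₃), -cos φ₃, 1, -cos φ₄, cos (φ₄+φ₅);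
     cos (φ₅+φ₆), -cos (φ₂+φ₃+φ₄), cos (φ₃+φ₄), -cos φ₄, 1, -cos φ₅;
     -cos φ₆, cos (φ₁+φ₆), -cos (φ₃+φ₄+φ₅), cos (φ₄+φ₅), -cos φ₅, 1]

section Copositive

variable {n : ℕ}

/-- If `u` is a nonnegative zero of a copositive form, then `B *ᵥ u` is nonnegative. -/
theorem Copositive.mulVec_nonneg {B : Matrix (Fin n) (Fin n) ℝ} (hB : B ∈ Copositive n)
    {u : Fin n → ℝ} (hu : ∀ i, 0 ≤ u i) (h0 : u ⬝ᵥ B *ᵥ u = 0) (i : Fin n) :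
    0 ≤ (B *ᵥ u) i := by
  have key : ∀ t : ℝ, 0 < t → 0 ≤ 2 * (B *ᵥ u) i + t * B i i := by
    intro t ht
    have h := hB.2 (u + Pi.single i t) (fun j => by
      have : 0 ≤ (Pi.single i t : Fin n → ℝ) j := by
        by_cases hj : j = i
        · subst hj; simpa using ht.le
        · simp [hj]
      simpa using add_nonneg (hu j) this)
    have hs : u ⬝ᵥ B *ᵥ Pi.single i t = t * (B *ᵥ u) i := by
      rw [dotProduct_mulVec, ← mulVec_transpose, hB.1.eq, dotProduct_single]
      ring
    rw [mulVec_add, add_dotProduct, dotProduct_add, dotProduct_add, h0, hs,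
      single_dotProduct, single_dotProduct, mulVec_single] at h
    simp only [Pi.smul_apply, col_apply, MulOpposite.smul_eq_mul_unop,
      MulOpposite.unop_op] at h
    have : 0 ≤ t * (2 * (B *ᵥ u) i + t * B i i) := by linarith
    exact nonneg_of_mul_nonneg_right this ht
  by_contra! hneg
  have hd : 0 < |B i i| + 1 := by positivity
  have h1 := key (-(B *ᵥ u) i / (|B i i| + 1)) (div_pos (by linarith) hd)
  have h2 : -(B *ᵥ u) i / (|B i i| + 1) * B i i ≤ -(B *ᵥ u) i := by
    rw [div_mul_eq_mul_div, div_le_iff₀ hd]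
    nlinarith [le_abs_self (B i i)]
  linarith

/-- In a decomposition of a matrix into copositive summands, a vanishing entry of the image of a
zero also vanishes for the first summand. -/
theorem Copositive.mulVec_eq_zero_of_add {B C : Matrix (Fin n) (Fin n) ℝ}
    (hB : B ∈ Copositive n) (hC : C ∈ Copositive n) {u : Fin n → ℝ} (hu : ∀ i, 0 ≤ u i)
    (h0 : u ⬝ᵥ (B + C) *ᵥ u = 0) {i : Fin n} (hi : ((B + C) *ᵥ u) i = 0) :
    (B *ᵥ u) i = 0 := by
  rw [add_mulVec, dotProduct_add] at h0
  rw [add_mulVec, Pi.add_apply] at hi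
  have hB0 := hB.2 u hu
  have hC0 := hC.2 u hu
  have h1 := Copositive.mulVec_nonneg hB hu (by linarith) i
  have h2 := Copositive.mulVec_nonneg hC hu (by linarith) i
  linarith

/-- A matrix with a zero `u` such that `A *ᵥ u` is nonnegative is copositive as soon as its form is
nonnegative on those faces of the orthant where a coordinate in the support of `u` vanishes. -/
theorem Copositive.of_faces {A : Matrix (Fin n) (Fin n) ℝ} (hA : A.IsSymm) {u : Fin n → ℝ}
    (hu : ∀ i, 0 ≤ u i) (hpos : ∃ i, 0 < u i) (h0 : u ⬝ᵥ A *ᵥ u = 0)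
    (hAu : ∀ i, 0 ≤ (A *ᵥ u) i)
    (hface : ∀ y : Fin n → ℝ, (∀ i, 0 ≤ y i) → ∀ k, 0 < u k → y k = 0 → 0 ≤ y ⬝ᵥ A *ᵥ y) :
    A ∈ Copositive n := by
  refine ⟨hA, fun x hx => ?_⟩
  obtain ⟨i₀, hi₀⟩ := hpos
  obtain ⟨k, hk, hmin⟩ := Finset.exists_min_image (Finset.univ.filter fun i => 0 < u i)
    (fun i => x i / u i) ⟨i₀, by simpa using hi₀⟩
  have hk : 0 < u k := by simpa using hk
  have ht : 0 ≤ x k / u k := div_nonneg (hx k) hk.le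
  have hy := hface (x - (x k / u k) • u) (fun i => by
    rcases (hu i).eq_or_lt with h | h
    · simpa [← h] using hx i
    · have := hmin i (by simpa using h)
      rw [le_div_iff₀ h] at this
      simpa using this) k hk (by simp [hk.ne'])
  have hs : u ⬝ᵥ A *ᵥ x = x ⬝ᵥ A *ᵥ u := by
    rw [dotProduct_mulVec, ← mulVec_transpose, hA.eq, dotProduct_comm]
  have hxu : 0 ≤ x ⬝ᵥ A *ᵥ u := Finset.sum_nonneg fun i _ => mul_nonneg (hx i) (hAu i)
  rw [mulVec_sub, sub_dotProduct, dotProduct_sub, dotProduct_sub, mulVec_smul,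
    dotProduct_smul, smul_dotProduct, smul_dotProduct, dotProduct_smul, h0, hs] at hy
  simp only [smul_eq_mul] at hy
  nlinarith [mul_nonneg ht hxu]

theorem mulVec_single_add_single_add_single (A : Matrix (Fin n) (Fin n) ℝ) (i j k l : Fin n)
    (p q r : ℝ) : (A *ᵥ (Pi.single i p + Pi.single j q + Pi.single k r)) l
      = A l i * p + A l j * q + A l k * r := by
  simp [mulVec_add, mulVec_single, mul_comm]

theorem single_add_single_add_single_dotProduct (v : Fin n → ℝ) (i j k : Fin n) (p q r : ℝ) :
    (Pi.single i p + Pi.single j q + Pi.single k r) ⬝ᵥ v = p * v i + q * v j + r * v k := by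
  simp [add_dotProduct]

theorem single_add_single_add_single_nonneg (i j k : Fin n) {p q r : ℝ} (hp : 0 ≤ p) (hq : 0 ≤ q)
    (hr : 0 ≤ r) (l : Fin n) :
    0 ≤ (Pi.single i p + Pi.single j q + Pi.single k r : Fin n → ℝ) l := by
  have hs : ∀ (m : Fin n) {t : ℝ}, 0 ≤ t → 0 ≤ (Pi.single m t : Fin n → ℝ) l := fun m t ht => by
    rw [Pi.single_apply]
    split_ifs <;> simp [ht]
  exact add_nonneg (add_nonneg (hs i hp) (hs j hq)) (hs k hr)

end Copositive

theorem cos_three_term (τ a b : ℝ) :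
    cos τ * sin b - cos (τ + a) * sin (a + b) + cos (τ + a + b) * sin a = 0 := by
  have := sin_sq_add_cos_sq a
  simp only [cos_add, sin_add]
  linear_combination (-(cos τ * sin b)) * this

theorem cos_three_term_zero (a b : ℝ) :
    sin b - cos a * sin (a + b) + cos (a + b) * sin a = 0 := by
  simpa using cos_three_term 0 a b

/-- The indices `i, j, k` span a degenerate positive semidefinite block of `A`, with consecutive
angles `a` and `b`. -/
structure IsWindow {n : ℕ} (A : Matrix (Fin n) (Fin n) ℝ) (i j k : Fin n) (a b : ℝ) : Prop where
  symm : A.IsSymm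
  pos_left : 0 < a
  pos_right : 0 < b
  add_lt : a + b < π
  diag_left : A i i = 1
  diag_mid : A j j = 1
  diag_right : A k k = 1
  left_mid : A i j = -cos a
  mid_right : A j k = -cos b
  left_right : A i k = cos (a + b)

namespace IsWindow

variable {n : ℕ} {A : Matrix (Fin n) (Fin n) ℝ} {i j k : Fin n} {a b : ℝ}

theorem row_left (h : IsWindow A i j k a b) :
    A i i * sin b + A i j * sin (a + b) + A i k * sin a = 0 := by
  rw [h.diag_left, h.left_mid, h.left_right]
  linear_combination cos_three_term_zero a b

theorem row_mid (h : IsWindow A i j k a b) :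
    A j i * sin b + A j j * sin (a + b) + A j k * sin a = 0 := by
  rw [h.symm.apply i j, h.diag_mid, h.left_mid, h.mid_right, sin_add]
  ring

theorem row_right (h : IsWindow A i j k a b) :
    A k i * sin b + A k j * sin (a + b) + A k k * sin a = 0 := by
  rw [h.symm.apply i k, h.left_right, h.symm.apply j k, h.mid_right, h.diag_right]
  have := cos_three_term_zero b a
  rw [add_comm b a] at this
  linear_combination this

theorem sin_left_pos (h : IsWindow A i j k a b) : 0 < sin a :=
  sin_pos_of_pos_of_lt_pi h.pos_left (by linarith [h.pos_right, h.add_lt])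

theorem sin_right_pos (h : IsWindow A i j k a b) : 0 < sin b :=
  sin_pos_of_pos_of_lt_pi h.pos_right (by linarith [h.pos_left, h.add_lt])

theorem sin_add_pos (h : IsWindow A i j k a b) : 0 < sin (a + b) :=
  sin_pos_of_pos_of_lt_pi (by linarith [h.pos_left, h.pos_right]) h.add_lt

theorem dotProduct_eq_zero (h : IsWindow A i j k a b) :
    (Pi.single i (sin b) + Pi.single j (sin (a + b)) + Pi.single k (sin a)) ⬝ᵥ
      A *ᵥ (Pi.single i (sin b) + Pi.single j (sin (a + b)) + Pi.single k (sin a)) = 0 := by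
  simp only [single_add_single_add_single_dotProduct, mulVec_single_add_single_add_single,
    h.row_left, h.row_mid, h.row_right]
  ring

theorem row_eq_zero {B C : Matrix (Fin n) (Fin n) ℝ} (hB : B ∈ Copositive n)
    (hC : C ∈ Copositive n) (h : IsWindow (B + C) i j k a b) (l : Fin n)
    (hl : (B + C) l i * sin b + (B + C) l j * sin (a + b) + (B + C) l k * sin a = 0) :
    B l i * sin b + B l j * sin (a + b) + B l k * sin a = 0 := by
  rw [← mulVec_single_add_single_add_single] at hl ⊢
  exact Copositive.mulVec_eq_zero_of_add hB hC (single_add_single_add_single_nonneg _ _ _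
    h.sin_right_pos.le h.sin_add_pos.le h.sin_left_pos.le) h.dotProduct_eq_zero hl

end IsWindow

/-- The general symmetric bilinear form on the plane, evaluated at two unit vectors. -/
noncomputable def planeForm (a b c θ τ : ℝ) : ℝ :=
  a * cos (θ - τ) + b * cos (θ + τ) + c * sin (θ + τ)

theorem planeForm_comm (a b c θ τ : ℝ) : planeForm a b c θ τ = planeForm a b c τ θ := by
  rw [planeForm, planeForm, ← cos_neg (θ - τ), neg_sub, add_comm θ τ]

/-- Propagation of a plane form along a three-term relation, up to alternating signs. -/
theorem planeForm_step {θ θ' θ'' α β p q r : ℝ} (a b c τ ε : ℝ) (hα : sin α ≠ 0)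
    (hθ' : θ' = θ + α) (hθ'' : θ'' = θ' + β)
    (h : p * sin β + q * sin (α + β) + r * sin α = 0)
    (hp : p = ε * planeForm a b c θ τ) (hq : q = -ε * planeForm a b c θ' τ) :
    r = ε * planeForm a b c θ'' τ := by
  subst hθ'' hθ'
  have key : planeForm a b c θ τ * sin β - planeForm a b c (θ + α) τ * sin (α + β)
      + planeForm a b c (θ + α + β) τ * sin α = 0 := by
    have h1 := cos_three_term (θ - τ) α β
    have h2 := cos_three_term (θ + τ) α β
    have h3 := cos_three_term (θ + τ - π / 2) α β
    have e1 : θ - τ + α = θ + α - τ := by ring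
    have e2 : θ + α - τ + β = θ + α + β - τ := by ring
    have e3 : θ + τ + α = θ + α + τ := by ring
    have e4 : θ + α + τ + β = θ + α + β + τ := by ring
    have e5 : θ + τ - π / 2 + α = θ + α + τ - π / 2 := by ring
    have e6 : θ + α + τ - π / 2 + β = θ + α + β + τ - π / 2 := by ring
    rw [e1, e2] at h1
    rw [e3, e4] at h2
    rw [e5, e6, cos_sub_pi_div_two, cos_sub_pi_div_two, cos_sub_pi_div_two] at h3
    simp only [planeForm]
    linear_combination a * h1 + b * h2 + c * h3
  refine mul_right_cancel₀ hα ?_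
  rw [hp, hq] at h
  linear_combination h - ε * key

theorem exists_planeForm {α : ℝ} (hα : sin α ≠ 0) (p q r : ℝ) : ∃ a b c : ℝ,
    p = planeForm a b c 0 0 ∧ q = -planeForm a b c α 0 ∧
      r = planeForm a b c α α := by
  have hsc := sin_sq_add_cos_sq α
  refine ⟨p - (p - r - 2 * cos α * (q + p * cos α)) / (2 * sin α ^ 2),
    (p - r - 2 * cos α * (q + p * cos α)) / (2 * sin α ^ 2),
    -(q + p * cos α) / sin α, ?_, ?_, ?_⟩
  · simp [planeForm]
  · simp only [planeForm, add_zero, sub_zero]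
    field_simp
    ring
  · simp only [planeForm, sub_self, cos_zero, ← two_mul, cos_two_mul, sin_two_mul]
    field_simp
    rw [show cos α ^ 2 = 1 - sin α ^ 2 by linarith]
    ring

/-- A form on the plane invariant under a rotation by `S`, which is not a multiple of `π`, is a
multiple of the Euclidean one. -/
theorem planeForm_rigid {a b c α S : ℝ} (hα : sin α ≠ 0) (hS : sin S ≠ 0)
    (h0 : planeForm a b c 0 0 = planeForm a b c S S)
    (h1 : planeForm a b c α 0 = planeForm a b c (S + α) S) : b = 0 ∧ c = 0 := by
  simp only [planeForm, add_zero, sub_self, sub_zero, cos_zero, sin_zero,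
    add_sub_cancel_left] at h0 h1
  rw [show S + α + S = (S + S) + α by ring, cos_add (S + S), sin_add (S + S)] at h1
  have e0 : b * (1 - cos (S + S)) - c * sin (S + S) = 0 := by linarith
  have e1 : b * sin (S + S) + c * (1 - cos (S + S)) = 0 := by
    refine mul_right_cancel₀ hα ?_
    linear_combination h1 - cos α * e0
  have hd : (1 - cos (S + S)) ^ 2 + sin (S + S) ^ 2 = 4 * sin S ^ 2 := by
    have := sin_sq_add_cos_sq (S + S)
    have h2 : cos (S + S) = 1 - 2 * sin S ^ 2 := by
      rw [← two_mul, cos_two_mul]; linarith [sin_sq_add_cos_sq S]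
    linear_combination this - 2 * h2
  have hd0 : 4 * sin S ^ 2 ≠ 0 := by positivity
  constructor
  · refine mul_right_cancel₀ hd0 ?_
    linear_combination (1 - cos (S + S)) * e0 + sin (S + S) * e1 - b * hd
  · refine mul_right_cancel₀ hd0 ?_
    linear_combination (1 - cos (S + S)) * e1 - sin (S + S) * e0 - c * hd

theorem cos_le_cos_of_add_le {s t : ℝ} (h0 : 0 ≤ t) (hts : t ≤ s) (h : s + t ≤ 2 * π) :
    cos s ≤ cos t := by
  have h1 := cos_sub_cos s t
  have h2 : 0 ≤ sin ((s + t) / 2) := sin_nonneg_of_nonneg_of_le_pi (by linarith) (by linarith)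
  have h3 : 0 ≤ sin ((s - t) / 2) :=
    sin_nonneg_of_nonneg_of_le_pi (by linarith) (by linarith)
  nlinarith [mul_nonneg h2 h3]

/-- The Gram form of unit vectors in the plane at angles `tᵢ` and with alternating signs. -/
theorem plane_gram_nonneg (x₁ x₂ x₃ x₄ x₅ x₆ t₁ t₂ t₃ t₄ t₅ t₆ : ℝ) :
    0 ≤ x₁ ^ 2 + x₂ ^ 2 + x₃ ^ 2 + x₄ ^ 2 + x₅ ^ 2 + x₆ ^ 2 + 2 * (
      -x₁ * x₂ * cos (t₂ - t₁) + x₁ * x₃ * cos (t₃ - t₁) - x₁ * x₄ * cos (t₄ - t₁)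
        + x₁ * x₅ * cos (t₅ - t₁) - x₁ * x₆ * cos (t₆ - t₁)
      - x₂ * x₃ * cos (t₃ - t₂) + x₂ * x₄ * cos (t₄ - t₂) - x₂ * x₅ * cos (t₅ - t₂)
        + x₂ * x₆ * cos (t₆ - t₂)
      - x₃ * x₄ * cos (t₄ - t₃) + x₃ * x₅ * cos (t₅ - t₃) - x₃ * x₆ * cos (t₆ - t₃)
      - x₄ * x₅ * cos (t₅ - t₄) + x₄ * x₆ * cos (t₆ - t₄)
      - x₅ * x₆ * cos (t₆ - t₅)) := by
  have h : 0 ≤ (x₁ * cos t₁ - x₂ * cos t₂ + x₃ * cos t₃ - x₄ * cos t₄ + x₅ * cos t₅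
    - x₆ * cos t₆) ^ 2 + (x₁ * sin t₁ - x₂ * sin t₂ + x₃ * sin t₃ - x₄ * sin t₄ + x₅ * sin t₅
    - x₆ * sin t₆) ^ 2 := by
    positivity
  simp only [cos_sub]
  linarith [congrArg (x₁ ^ 2 * ·) (sin_sq_add_cos_sq t₁),
    congrArg (x₂ ^ 2 * ·) (sin_sq_add_cos_sq t₂), congrArg (x₃ ^ 2 * ·) (sin_sq_add_cos_sq t₃),
    congrArg (x₄ ^ 2 * ·) (sin_sq_add_cos_sq t₄), congrArg (x₅ ^ 2 * ·) (sin_sq_add_cos_sq t₅),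
    congrArg (x₆ ^ 2 * ·) (sin_sq_add_cos_sq t₆)]

/-- The Gram form of unit vectors in the plane with consecutive angles `aᵢ` and alternating
signs. -/
theorem path_form_nonneg (x₁ x₂ x₃ x₄ x₅ x₆ a₁ a₂ a₃ a₄ a₅ : ℝ) :
    0 ≤ x₁ ^ 2 + x₂ ^ 2 + x₃ ^ 2 + x₄ ^ 2 + x₅ ^ 2 + x₆ ^ 2 + 2 * (
      -x₁ * x₂ * cos a₁ + x₁ * x₃ * cos (a₁ + a₂) - x₁ * x₄ * cos (a₁ + a₂ + a₃)
        + x₁ * x₅ * cos (a₁ + a₂ + a₃ + a₄) - x₁ * x₆ * cos (a₁ + a₂ + a₃ + a₄ + a₅)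
      - x₂ * x₃ * cos a₂ + x₂ * x₄ * cos (a₂ + a₃) - x₂ * x₅ * cos (a₂ + a₃ + a₄)
        + x₂ * x₆ * cos (a₂ + a₃ + a₄ + a₅)
      - x₃ * x₄ * cos a₃ + x₃ * x₅ * cos (a₃ + a₄) - x₃ * x₆ * cos (a₃ + a₄ + a₅)
      - x₄ * x₅ * cos a₄ + x₄ * x₆ * cos (a₄ + a₅)
      - x₅ * x₆ * cos a₅) := by
  have h := plane_gram_nonneg x₁ x₂ x₃ x₄ x₅ x₆ 0 a₁ (a₁ + a₂) (a₁ + a₂ + a₃)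
    (a₁ + a₂ + a₃ + a₄) (a₁ + a₂ + a₃ + a₄ + a₅)
  ring_nf at h ⊢
  exact h

section A131

variable {φ₁ φ₂ φ₃ φ₄ φ₅ φ₆ : ℝ}

theorem A131_isSymm (φ₁ φ₂ φ₃ φ₄ φ₅ φ₆ : ℝ) : (A131 φ₁ φ₂ φ₃ φ₄ φ₅ φ₆).IsSymm := by
  ext i j
  fin_cases i <;> fin_cases j <;> rfl

theorem A131_window₁ (h₁ : 0 < φ₁) (h₂ : 0 < φ₂) (h : φ₁ + φ₂ < π) :
    IsWindow (A131 φ₁ φ₂ φ₃ φ₄ φ₅ φ₆) 0 1 2 φ₁ φ₂ :=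
  ⟨A131_isSymm .., h₁, h₂, h, rfl, rfl, rfl, rfl, rfl, rfl⟩

theorem A131_window₂ (h₂ : 0 < φ₂) (h₃ : 0 < φ₃) (h : φ₂ + φ₃ < π) :
    IsWindow (A131 φ₁ φ₂ φ₃ φ₄ φ₅ φ₆) 1 2 3 φ₂ φ₃ :=
  ⟨A131_isSymm .., h₂, h₃, h, rfl, rfl, rfl, rfl, rfl, rfl⟩

theorem A131_window₃ (h₃ : 0 < φ₃) (h₄ : 0 < φ₄) (h : φ₃ + φ₄ < π) :
    IsWindow (A131 φ₁ φ₂ φ₃ φ₄ φ₅ φ₆) 2 3 4 φ₃ φ₄ :=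
  ⟨A131_isSymm .., h₃, h₄, h, rfl, rfl, rfl, rfl, rfl, rfl⟩

theorem A131_window₄ (h₄ : 0 < φ₄) (h₅ : 0 < φ₅) (h : φ₄ + φ₅ < π) :
    IsWindow (A131 φ₁ φ₂ φ₃ φ₄ φ₅ φ₆) 3 4 5 φ₄ φ₅ :=
  ⟨A131_isSymm .., h₄, h₅, h, rfl, rfl, rfl, rfl, rfl, rfl⟩

theorem A131_window₅ (h₅ : 0 < φ₅) (h₆ : 0 < φ₆) (h : φ₅ + φ₆ < π) :
    IsWindow (A131 φ₁ φ₂ φ₃ φ₄ φ₅ φ₆) 4 5 0 φ₅ φ₆ :=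
  ⟨A131_isSymm .., h₅, h₆, h, rfl, rfl, rfl, rfl, rfl, rfl⟩

theorem A131_window₆ (h₆ : 0 < φ₆) (h₁ : 0 < φ₁) (h : φ₆ + φ₁ < π) :
    IsWindow (A131 φ₁ φ₂ φ₃ φ₄ φ₅ φ₆) 5 0 1 φ₆ φ₁ :=
  ⟨A131_isSymm .., h₆, h₁, h, rfl, rfl, rfl, rfl, rfl, by
    rw [add_comm φ₆ φ₁]; rfl⟩

theorem A131_dotProduct_mulVec (x : Fin 6 → ℝ) : x ⬝ᵥ A131 φ₁ φ₂ φ₃ φ₄ φ₅ φ₆ *ᵥ x =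
    x 0 ^ 2 + x 1 ^ 2 + x 2 ^ 2 + x 3 ^ 2 + x 4 ^ 2 + x 5 ^ 2 + 2 * (
      -(x 0 * x 1) * cos φ₁ + x 0 * x 2 * cos (φ₁ + φ₂) - x 0 * x 3 * cos (φ₁ + φ₂ + φ₃)
        + x 0 * x 4 * cos (φ₅ + φ₆) - x 0 * x 5 * cos φ₆
      - x 1 * x 2 * cos φ₂ + x 1 * x 3 * cos (φ₂ + φ₃) - x 1 * x 4 * cos (φ₂ + φ₃ + φ₄)
        + x 1 * x 5 * cos (φ₁ + φ₆)
      - x 2 * x 3 * cos φ₃ + x 2 * x 4 * cos (φ₃ + φ₄) - x 2 * x 5 * cos (φ₃ + φ₄ + φ₅)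
      - x 3 * x 4 * cos φ₄ + x 3 * x 5 * cos (φ₄ + φ₅)
      - x 4 * x 5 * cos φ₅) := by
  simp only [A131, dotProduct, mulVec, Fin.sum_univ_six, of_apply, cons_val]
  ring

/-- The form is nonnegative on the faces of the orthant opposite to the sixth, first and second
vertices. -/
theorem A131_face_nonneg
    (h₁ : 0 < φ₁) (h₂ : 0 < φ₂) (h₄ : 0 < φ₄) (h₅ : 0 < φ₅) (h₆ : 0 < φ₆)
    (hsum : φ₁ + φ₂ + φ₃ + φ₄ + φ₅ + φ₆ < 2 * π)
    (hA : φ₄ + φ₅ + φ₆ < φ₁ + φ₂ + φ₃) (hB : φ₁ + φ₂ + φ₆ < φ₃ + φ₄ + φ₅)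
    {x : Fin 6 → ℝ} (hx : ∀ i, 0 ≤ x i) (h0 : x 0 * x 5 = 0 ∨ x 0 * x 1 = 0) :
    0 ≤ x ⬝ᵥ A131 φ₁ φ₂ φ₃ φ₄ φ₅ φ₆ *ᵥ x := by
  have hxx i j : 0 ≤ x i * x j := mul_nonneg (hx i) (hx j)
  have e15 : cos (φ₂ + φ₃ + φ₄ + φ₅) ≤ cos (φ₁ + φ₆) :=
    cos_le_cos_of_add_le (by linarith) (by linarith) (by linarith)
  have m15 := mul_le_mul_of_nonneg_left e15 (hxx 1 5)
  rw [A131_dotProduct_mulVec]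
  rcases h0 with h0 | h0
  · have e04 : cos (φ₁ + φ₂ + φ₃ + φ₄) ≤ cos (φ₅ + φ₆) :=
      cos_le_cos_of_add_le (by linarith) (by linarith) (by linarith)
    have m04 := mul_le_mul_of_nonneg_left e04 (hxx 0 4)
    have p := path_form_nonneg (x 0) (x 1) (x 2) (x 3) (x 4) (x 5) φ₁ φ₂ φ₃ φ₄ φ₅
    rw [h0] at p ⊢
    linarith
  · have e02 : cos (φ₃ + φ₄ + φ₅ + φ₆) ≤ cos (φ₁ + φ₂) :=
      cos_le_cos_of_add_le (by linarith) (by linarith) (by linarith)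
    have e03 : cos (φ₁ + φ₂ + φ₃) ≤ cos (φ₄ + φ₅ + φ₆) :=
      cos_le_cos_of_add_le (by linarith) (by linarith) (by linarith)
    have m02 := mul_le_mul_of_nonneg_left e02 (hxx 0 2)
    have m03 := mul_le_mul_of_nonneg_left e03 (hxx 0 3)
    have p := path_form_nonneg (x 1) (x 2) (x 3) (x 4) (x 5) (x 0) φ₂ φ₃ φ₄ φ₅ φ₆
    rw [mul_comm (x 1) (x 0), h0] at p
    rw [h0]
    linarith

theorem A131_row_zero_window₂ (φ₁ φ₂ φ₃ φ₄ φ₅ φ₆ : ℝ) :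
    A131 φ₁ φ₂ φ₃ φ₄ φ₅ φ₆ 0 1 * sin φ₃ + A131 φ₁ φ₂ φ₃ φ₄ φ₅ φ₆ 0 2 * sin (φ₂ + φ₃)
      + A131 φ₁ φ₂ φ₃ φ₄ φ₅ φ₆ 0 3 * sin φ₂ = 0 := by
  have h := cos_three_term φ₁ φ₂ φ₃
  simp only [A131, of_apply, cons_val]
  linarith

theorem A131_row_one_window₃ (φ₁ φ₂ φ₃ φ₄ φ₅ φ₆ : ℝ) :
    A131 φ₁ φ₂ φ₃ φ₄ φ₅ φ₆ 1 2 * sin φ₄ + A131 φ₁ φ₂ φ₃ φ₄ φ₅ φ₆ 1 3 * sin (φ₃ + φ₄)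
      + A131 φ₁ φ₂ φ₃ φ₄ φ₅ φ₆ 1 4 * sin φ₃ = 0 := by
  have h := cos_three_term φ₂ φ₃ φ₄
  simp only [A131, of_apply, cons_val]
  linarith

theorem A131_row_two_window₄ (φ₁ φ₂ φ₃ φ₄ φ₅ φ₆ : ℝ) :
    A131 φ₁ φ₂ φ₃ φ₄ φ₅ φ₆ 2 3 * sin φ₅ + A131 φ₁ φ₂ φ₃ φ₄ φ₅ φ₆ 2 4 * sin (φ₄ + φ₅)
      + A131 φ₁ φ₂ φ₃ φ₄ φ₅ φ₆ 2 5 * sin φ₄ = 0 := by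
  have h := cos_three_term φ₃ φ₄ φ₅
  simp only [A131, of_apply, cons_val]
  linarith

theorem A131_copositive
    (h₁ : 0 < φ₁) (h₂ : 0 < φ₂) (h₄ : 0 < φ₄) (h₅ : 0 < φ₅) (h₆ : 0 < φ₆)
    (hsum : φ₁ + φ₂ + φ₃ + φ₄ + φ₅ + φ₆ < 2 * π) (h16 : φ₁ + φ₆ < π)
    (hA : φ₄ + φ₅ + φ₆ < φ₁ + φ₂ + φ₃) (hB : φ₁ + φ₂ + φ₆ < φ₃ + φ₄ + φ₅)
    (hC : φ₁ + φ₅ + φ₆ < φ₂ + φ₃ + φ₄) :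
    A131 φ₁ φ₂ φ₃ φ₄ φ₅ φ₆ ∈ Copositive 6 := by
  have w : IsWindow (A131 φ₁ φ₂ φ₃ φ₄ φ₅ φ₆) 5 0 1 φ₆ φ₁ :=
    A131_window₆ h₆ h₁ ((add_comm _ _).trans_lt h16)
  refine Copositive.of_faces (A131_isSymm ..) (single_add_single_add_single_nonneg _ _ _
    w.sin_right_pos.le w.sin_add_pos.le w.sin_left_pos.le) ⟨5, ?_⟩ w.dotProduct_eq_zero ?_ ?_
  · simpa using w.sin_right_pos
  · intro l
    rw [mulVec_single_add_single_add_single]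
    fin_cases l
    · exact w.row_mid.ge
    · exact w.row_right.ge
    · have e : cos (φ₃ + φ₄ + φ₅) ≤ cos (φ₂ + φ₁ + φ₆) :=
        cos_le_cos_of_add_le (by linarith) (by linarith) (by linarith)
      have m := mul_le_mul_of_nonneg_right e w.sin_right_pos.le
      have h := cos_three_term φ₂ φ₁ φ₆
      simp only [Fin.reduceFinMk, A131, of_apply, cons_val]
      rw [add_comm φ₆ φ₁, add_comm φ₁ φ₂]
      linarith
    · have e : cos (φ₂ + φ₃ + φ₁ + φ₆) ≤ cos (φ₄ + φ₅) :=
        cos_le_cos_of_add_le (by linarith) (by linarith) (by linarith)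
      have m := mul_le_mul_of_nonneg_right e w.sin_right_pos.le
      have h := cos_three_term (φ₂ + φ₃) φ₁ φ₆
      simp only [Fin.reduceFinMk, A131, of_apply, cons_val]
      rw [add_comm φ₆ φ₁, add_assoc φ₁, add_comm φ₁ (φ₂ + φ₃)]
      linarith
    · have e : cos (φ₂ + φ₃ + φ₄) ≤ cos (φ₅ + φ₆ + φ₁) :=
        cos_le_cos_of_add_le (by linarith) (by linarith) (by linarith)
      have m := mul_le_mul_of_nonneg_right e w.sin_left_pos.le
      have h := cos_three_term φ₅ φ₆ φ₁
      simp only [Fin.reduceFinMk, A131, of_apply, cons_val]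
      linarith
    · exact w.row_left.ge
  · intro y hy k hk hyk
    refine A131_face_nonneg h₁ h₂ h₄ h₅ h₆ hsum hA hB hy ?_
    fin_cases k
    · exact Or.inl (mul_eq_zero_of_left hyk _)
    · exact Or.inr (mul_eq_zero_of_right _ hyk)
    · simp at hk
    · simp at hk
    · simp at hk
    · exact Or.inl (mul_eq_zero_of_right _ hyk)

theorem A131_summand_eq_smul
    (h₁ : 0 < φ₁) (h₂ : 0 < φ₂) (h₃ : 0 < φ₃) (h₄ : 0 < φ₄) (h₅ : 0 < φ₅) (h₆ : 0 < φ₆)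
    (h12 : φ₁ + φ₂ < π) (h23 : φ₂ + φ₃ < π) (h34 : φ₃ + φ₄ < π)
    (h45 : φ₄ + φ₅ < π) (h56 : φ₅ + φ₆ < π) (h16 : φ₁ + φ₆ < π)
    (hS : sin (φ₁ + φ₂ + φ₃ + φ₄ + φ₅ + φ₆) ≠ 0)
    {B C : Matrix (Fin 6) (Fin 6) ℝ} (hB : B ∈ Copositive 6) (hC : C ∈ Copositive 6)
    (hBC : A131 φ₁ φ₂ φ₃ φ₄ φ₅ φ₆ = B + C) :
    ∃ a : ℝ, 0 ≤ a ∧ B = a • A131 φ₁ φ₂ φ₃ φ₄ φ₅ φ₆ := by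
  have hs : B.IsSymm := hB.1
  have w₁ : IsWindow (B + C) 0 1 2 φ₁ φ₂ := hBC ▸ A131_window₁ h₁ h₂ h12
  have w₂ : IsWindow (B + C) 1 2 3 φ₂ φ₃ := hBC ▸ A131_window₂ h₂ h₃ h23
  have w₃ : IsWindow (B + C) 2 3 4 φ₃ φ₄ := hBC ▸ A131_window₃ h₃ h₄ h34
  have w₄ : IsWindow (B + C) 3 4 5 φ₄ φ₅ := hBC ▸ A131_window₄ h₄ h₅ h45
  have w₅ : IsWindow (B + C) 4 5 0 φ₅ φ₆ := hBC ▸ A131_window₅ h₅ h₆ h56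
  have w₆ : IsWindow (B + C) 5 0 1 φ₆ φ₁ := hBC ▸ A131_window₆ h₆ h₁ ((add_comm _ _).trans_lt h16)
  obtain ⟨a, b, c, g00, g01, g11⟩ :=
    exists_planeForm w₁.sin_left_pos.ne' (B 0 0) (B 0 1) (B 1 1)
  have g10 : B 1 0 = -planeForm a b c 0 φ₁ := by rw [hs.apply 0 1, g01, planeForm_comm]
  obtain ⟨t₂, ht₂⟩ : ∃ t, t = φ₁ + φ₂ := ⟨_, rfl⟩
  obtain ⟨t₃, ht₃⟩ : ∃ t, t = t₂ + φ₃ := ⟨_, rfl⟩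
  obtain ⟨t₄, ht₄⟩ : ∃ t, t = t₃ + φ₄ := ⟨_, rfl⟩
  obtain ⟨t₅, ht₅⟩ : ∃ t, t = t₄ + φ₅ := ⟨_, rfl⟩
  obtain ⟨t₆, ht₆⟩ : ∃ t, t = t₅ + φ₆ := ⟨_, rfl⟩
  obtain ⟨t₇, ht₇⟩ : ∃ t, t = t₆ + φ₁ := ⟨_, rfl⟩
  have g02 : B 0 2 = planeForm a b c t₂ 0 := by
    linarith [planeForm_step a b c 0 1 w₁.sin_left_pos.ne' (zero_add φ₁).symm ht₂
      (w₁.row_eq_zero hB hC 0 w₁.row_left) (by linarith) (by linarith)]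
  have g20 : B 2 0 = planeForm a b c 0 t₂ := by
    rw [hs.apply 0 2, g02, planeForm_comm]
  have g12 : B 1 2 = -planeForm a b c t₂ φ₁ := by
    linarith [planeForm_step a b c φ₁ (-1) w₁.sin_left_pos.ne' (zero_add φ₁).symm ht₂
      (w₁.row_eq_zero hB hC 1 w₁.row_mid) (by linarith) (by linarith)]
  have g21 : B 2 1 = -planeForm a b c φ₁ t₂ := by
    rw [hs.apply 1 2, g12, planeForm_comm]
  have g22 : B 2 2 = planeForm a b c t₂ t₂ := by
    linarith [planeForm_step a b c t₂ 1 w₁.sin_left_pos.ne' (zero_add φ₁).symm ht₂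
      (w₁.row_eq_zero hB hC 2 w₁.row_right) (by linarith) (by linarith)]
  have g03 : B 0 3 = -planeForm a b c t₃ 0 := by
    linarith [planeForm_step a b c 0 (-1) w₂.sin_left_pos.ne' ht₂ ht₃
      (w₂.row_eq_zero hB hC 0 (hBC ▸ A131_row_zero_window₂ ..)) (by linarith) (by linarith)]
  have g13 : B 1 3 = planeForm a b c t₃ φ₁ := by
    linarith [planeForm_step a b c φ₁ 1 w₂.sin_left_pos.ne' ht₂ ht₃
      (w₂.row_eq_zero hB hC 1 w₂.row_left) (by linarith) (by linarith)]
  have g31 : B 3 1 = planeForm a b c φ₁ t₃ := by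
    rw [hs.apply 1 3, g13, planeForm_comm]
  have g23 : B 2 3 = -planeForm a b c t₃ t₂ := by
    linarith [planeForm_step a b c t₂ (-1) w₂.sin_left_pos.ne' ht₂ ht₃
      (w₂.row_eq_zero hB hC 2 w₂.row_mid) (by linarith) (by linarith)]
  have g32 : B 3 2 = -planeForm a b c t₂ t₃ := by
    rw [hs.apply 2 3, g23, planeForm_comm]
  have g33 : B 3 3 = planeForm a b c t₃ t₃ := by
    linarith [planeForm_step a b c t₃ 1 w₂.sin_left_pos.ne' ht₂ ht₃
      (w₂.row_eq_zero hB hC 3 w₂.row_right) (by linarith) (by linarith)]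
  have g14 : B 1 4 = -planeForm a b c t₄ φ₁ := by
    linarith [planeForm_step a b c φ₁ (-1) w₃.sin_left_pos.ne' ht₃ ht₄
      (w₃.row_eq_zero hB hC 1 (hBC ▸ A131_row_one_window₃ ..)) (by linarith) (by linarith)]
  have g24 : B 2 4 = planeForm a b c t₄ t₂ := by
    linarith [planeForm_step a b c t₂ 1 w₃.sin_left_pos.ne' ht₃ ht₄
      (w₃.row_eq_zero hB hC 2 w₃.row_left) (by linarith) (by linarith)]
  have g42 : B 4 2 = planeForm a b c t₂ t₄ := by
    rw [hs.apply 2 4, g24, planeForm_comm]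
  have g34 : B 3 4 = -planeForm a b c t₄ t₃ := by
    linarith [planeForm_step a b c t₃ (-1) w₃.sin_left_pos.ne' ht₃ ht₄
      (w₃.row_eq_zero hB hC 3 w₃.row_mid) (by linarith) (by linarith)]
  have g43 : B 4 3 = -planeForm a b c t₃ t₄ := by
    rw [hs.apply 3 4, g34, planeForm_comm]
  have g44 : B 4 4 = planeForm a b c t₄ t₄ := by
    linarith [planeForm_step a b c t₄ 1 w₃.sin_left_pos.ne' ht₃ ht₄
      (w₃.row_eq_zero hB hC 4 w₃.row_right) (by linarith) (by linarith)]
  have g25 : B 2 5 = -planeForm a b c t₅ t₂ := by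
    linarith [planeForm_step a b c t₂ (-1) w₄.sin_left_pos.ne' ht₄ ht₅
      (w₄.row_eq_zero hB hC 2 (hBC ▸ A131_row_two_window₄ ..)) (by linarith) (by linarith)]
  have g35 : B 3 5 = planeForm a b c t₅ t₃ := by
    linarith [planeForm_step a b c t₃ 1 w₄.sin_left_pos.ne' ht₄ ht₅
      (w₄.row_eq_zero hB hC 3 w₄.row_left) (by linarith) (by linarith)]
  have g53 : B 5 3 = planeForm a b c t₃ t₅ := by
    rw [hs.apply 3 5, g35, planeForm_comm]
  have g45 : B 4 5 = -planeForm a b c t₅ t₄ := by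
    linarith [planeForm_step a b c t₄ (-1) w₄.sin_left_pos.ne' ht₄ ht₅
      (w₄.row_eq_zero hB hC 4 w₄.row_mid) (by linarith) (by linarith)]
  have g54 : B 5 4 = -planeForm a b c t₄ t₅ := by
    rw [hs.apply 4 5, g45, planeForm_comm]
  have g55 : B 5 5 = planeForm a b c t₅ t₅ := by
    linarith [planeForm_step a b c t₅ 1 w₄.sin_left_pos.ne' ht₄ ht₅
      (w₄.row_eq_zero hB hC 5 w₄.row_right) (by linarith) (by linarith)]
  have g40 : B 4 0 = planeForm a b c t₆ t₄ := by
    linarith [planeForm_step a b c t₄ 1 w₅.sin_left_pos.ne' ht₅ ht₆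
      (w₅.row_eq_zero hB hC 4 w₅.row_left) (by linarith) (by linarith)]
  have g04 : B 0 4 = planeForm a b c t₄ t₆ := by
    rw [hs.apply 4 0, g40, planeForm_comm]
  have g50 : B 5 0 = -planeForm a b c t₆ t₅ := by
    linarith [planeForm_step a b c t₅ (-1) w₅.sin_left_pos.ne' ht₅ ht₆
      (w₅.row_eq_zero hB hC 5 w₅.row_mid) (by linarith) (by linarith)]
  have g05 : B 0 5 = -planeForm a b c t₅ t₆ := by
    rw [hs.apply 5 0, g50, planeForm_comm]
  have gw00 : B 0 0 = planeForm a b c t₆ t₆ := by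
    linarith [planeForm_step a b c t₆ 1 w₅.sin_left_pos.ne' ht₅ ht₆
      (w₅.row_eq_zero hB hC 0 w₅.row_right) (by linarith) (by linarith)]
  have g51 : B 5 1 = planeForm a b c t₇ t₅ := by
    linarith [planeForm_step a b c t₅ 1 w₆.sin_left_pos.ne' ht₆ ht₇
      (w₆.row_eq_zero hB hC 5 w₆.row_left) (by linarith) (by linarith)]
  have gw01 : B 0 1 = -planeForm a b c t₇ t₆ := by
    linarith [planeForm_step a b c t₆ (-1) w₆.sin_left_pos.ne' ht₆ ht₇
      (w₆.row_eq_zero hB hC 0 w₆.row_mid) (by linarith) (by linarith)]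
  have ht₆' : t₆ = φ₁ + φ₂ + φ₃ + φ₄ + φ₅ + φ₆ := by linarith
  have ht₇' : t₇ = φ₁ + φ₂ + φ₃ + φ₄ + φ₅ + φ₆ + φ₁ := by linarith
  obtain ⟨rfl, rfl⟩ : b = 0 ∧ c = 0 :=
    planeForm_rigid (S := φ₁ + φ₂ + φ₃ + φ₄ + φ₅ + φ₆) w₁.sin_left_pos.ne' hS
      (by rw [← ht₆', ← g00, gw00]) (by rw [← ht₇', ← ht₆', ← neg_inj, ← g01, gw01])
  refine ⟨a, ?_, ?_⟩
  · have h := hB.2 (Pi.single 0 1) (fun i => by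
      rw [Pi.single_apply]
      split_ifs <;> simp)
    simpa [g00, planeForm] using h
  · have key : ∀ i j, i ≤ j → B i j = a * A131 φ₁ φ₂ φ₃ φ₄ φ₅ φ₆ i j := by
      have k04 : B 0 4 = planeForm a 0 0 t₆ t₄ := by rw [hs.apply 4 0, g40]
      have k05 : B 0 5 = -planeForm a 0 0 t₆ t₅ := by rw [hs.apply 5 0, g50]
      have k15 : B 1 5 = planeForm a 0 0 t₇ t₅ := by rw [hs.apply 5 1, g51]
      clear g04 g05
      intro i j hij
      fin_cases i <;> fin_cases j <;>
        first
        | exact absurd hij (by decide)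
        | (simp only [Fin.reduceFinMk, Fin.zero_eta, Fin.mk_one, g00, g01, g02, g03, k04, k05,
            g11, g12, g13, g14, k15, g22, g23, g24, g25, g33, g34, g35, g44, g45, g55, planeForm,
            ht₇, ht₆, ht₅, ht₄, ht₃, ht₂, A131, of_apply, cons_val, zero_mul, add_zero, sub_self,
            sub_zero, cos_zero]
           try ring_nf)
    ext i j
    rw [Matrix.smul_apply, smul_eq_mul]
    rcases le_total i j with h | h
    · exact key i j h
    · rw [hs.apply j i, (A131_isSymm ..).apply j i, key j i h]

end A131

theorem A131_extremal
    (φ₁ φ₂ φ₃ φ₄ φ₅ φ₆ : ℝ)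
    (h₁ : 0 < φ₁) (h₂ : 0 < φ₂) (h₃ : 0 < φ₃) (h₄ : 0 < φ₄) (h₅ : 0 < φ₅) (h₆ : 0 < φ₆)
    (hsum : φ₁ + φ₂ + φ₃ + φ₄ + φ₅ + φ₆ < 2 * π)
    (h12 : φ₁ + φ₂ < π) (h23 : φ₂ + φ₃ < π) (h34 : φ₃ + φ₄ < π)
    (h45 : φ₄ + φ₅ < π) (h56 : φ₅ + φ₆ < π) (h16 : φ₁ + φ₆ < π)
    (hA : φ₁ + φ₂ + φ₃ > φ₄ + φ₅ + φ₆)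
    (hB : φ₃ + φ₄ + φ₅ > φ₁ + φ₂ + φ₆)
    (hC : φ₂ + φ₃ + φ₄ > φ₁ + φ₅ + φ₆)
    (hne : φ₁ + φ₂ + φ₃ + φ₄ + φ₅ + φ₆ ≠ π) :
    IsExtremalCopositive 6 (A131 φ₁ φ₂ φ₃ φ₄ φ₅ φ₆) := by
  have hS : sin (φ₁ + φ₂ + φ₃ + φ₄ + φ₅ + φ₆) ≠ 0 := by
    rcases hne.lt_or_gt with h | h
    · exact (sin_pos_of_pos_of_lt_pi (by linarith) h).ne'
    · have h0 : 0 < sin (φ₁ + φ₂ + φ₃ + φ₄ + φ₅ + φ₆ - π) :=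
        sin_pos_of_pos_of_lt_pi (by linarith) (by linarith)
      rw [sin_sub_pi] at h0
      exact (neg_pos.1 h0).ne
  refine ⟨A131_copositive h₁ h₂ h₄ h₅ h₆ hsum h16 hA hB hC, fun h => ?_, ?_⟩
  · have h00 : (1 : ℝ) = 0 := congrFun (congrFun h 0) 0
    exact one_ne_zero h00
  · intro B C hBcop hCcop hBC
    obtain ⟨c₁, hc₁, e₁⟩ := A131_summand_eq_smul h₁ h₂ h₃ h₄ h₅ h₆ h12 h23 h34 h45 h56 h16 hS
      hBcop hCcop hBC
    obtain ⟨c₂, hc₂, e₂⟩ := A131_summand_eq_smul h₁ h₂ h₃ h₄ h₅ h₆ h12 h23 h34 h45 h56 h16 hS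
      hCcop hBcop (hBC.trans (add_comm B C))
    exact ⟨c₁, c₂, hc₁, hc₂, e₁, e₂⟩
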